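/- Let n ≥ 2 and let k be a nonzero integer. For every w ∈ G(∞,∞,n): w ⪯ λ^k if and only if for every matrix index (j,d) ∈ Z'(w), the entry w[j,d] is equal to 0, 1, or x^k. -/

import Mathlib

/-- The indeterminate `x` in the field `K = ℚ(x)` of rational functions over `ℚ`. -/
noncomputable def xx : RatFunc ℚ := RatFunc.X

/-- Membership in `G(∞,∞,n)`: a monomial matrix whose nonzero entries are integer powers
of `x` and such that the product of the nonzero entries is `1`. -/
def IsGinf (n : ℕ) (w : Matrix (Fin n) (Fin n) (RatFunc ℚ)) : Prop :=
  (∀ i : Fin n, ∃! c : Fin n, w i c ≠ 0) ∧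
  (∀ c : Fin n, ∃! i : Fin n, w i c ≠ 0) ∧
  (∀ i c : Fin n, w i c ≠ 0 → ∃ k : ℤ, w i c = xx ^ k) ∧
  (∏ i : Fin n, ∑ c : Fin n, w i c) = 1

/-- The generator `t_i` (1-indexed rows/columns 1,2 are `Fin` indices 0,1). -/
noncomputable def tMat (n : ℕ) (i : ℤ) : Matrix (Fin n) (Fin n) (RatFunc ℚ) :=
  fun r c =>
    if r.val = 0 ∧ c.val = 1 then xx ^ (-i)
    else if r.val = 1 ∧ c.val = 0 then xx ^ i
    else if r = c ∧ 2 ≤ r.val then 1 else 0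

/-- The generator `s_j` (`3 ≤ j ≤ n`): permutation matrix of the transposition exchanging
coordinates `j-1` and `j` (1-indexed), i.e. `Fin` indices `j-2` and `j-1`. -/
noncomputable def sMat (n : ℕ) (j : ℕ) : Matrix (Fin n) (Fin n) (RatFunc ℚ) :=
  fun r c =>
    if (r.val + 2 = j ∧ c.val + 1 = j) ∨ (r.val + 1 = j ∧ c.val + 2 = j) ∨
       (r = c ∧ r.val + 2 ≠ j ∧ r.val + 1 ≠ j) then 1 else 0

/-- The generating set `X = {t_i : i ∈ ℤ} ∪ {s_j : 3 ≤ j ≤ n}`. -/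
def Xset (n : ℕ) : Set (Matrix (Fin n) (Fin n) (RatFunc ℚ)) :=
  {w | (∃ i : ℤ, w = tMat n i) ∨ (∃ j : ℕ, 3 ≤ j ∧ j ≤ n ∧ w = sMat n j)}

/-- `len n w` is the minimal `m` such that `w` is a product of `m` elements of `X`. -/
noncomputable def len (n : ℕ) (w : Matrix (Fin n) (Fin n) (RatFunc ℚ)) : ℕ :=
  sInf {m | ∃ L : List (Matrix (Fin n) (Fin n) (RatFunc ℚ)),
    L.length = m ∧ (∀ a ∈ L, a ∈ Xset n) ∧ L.prod = w}

/-- Left divisibility: `v ⪯ w` iff `ℓ(v) + ℓ(v⁻¹ w) = ℓ(w)`. -/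
def preL (n : ℕ) (v w : Matrix (Fin n) (Fin n) (RatFunc ℚ)) : Prop :=
  len n v + len n (v⁻¹ * w) = len n w

/-- Right divisibility: `v ⪯_r w` iff `ℓ(w v⁻¹) + ℓ(v) = ℓ(w)`. -/
def preR (n : ℕ) (v w : Matrix (Fin n) (Fin n) (RatFunc ℚ)) : Prop :=
  len n (w * v⁻¹) + len n v = len n w

/-- The element `λ = diag(x^{-(n-1)}, x, …, x)`. -/
noncomputable def lam (n : ℕ) : Matrix (Fin n) (Fin n) (RatFunc ℚ) :=
  Matrix.diagonal (fun i => if i.val = 0 then xx ^ (-((n : ℤ) - 1)) else xx)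

/-- An index `(i,c)` is a bubble of `w` if every entry weakly above and to the left of it
(other than itself) is zero. -/
def IsBubble (n : ℕ) (w : Matrix (Fin n) (Fin n) (RatFunc ℚ)) (i c : Fin n) : Prop :=
  ∀ j d : Fin n, j ≤ i → d ≤ c → ¬(j = i ∧ d = c) → w j d = 0

/-- `Z(w)`: the set of indices lying weakly above and to the left of some bubble. -/
def Zset (n : ℕ) (w : Matrix (Fin n) (Fin n) (RatFunc ℚ)) : Set (Fin n × Fin n) :=
  {p | ∃ i c : Fin n, IsBubble n w i c ∧ p.1 ≤ i ∧ p.2 ≤ c}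

theorem xx_ne_zero : xx ≠ 0 := RatFunc.X_ne_zero

theorem xx_zpow_eq_one {k : ℤ} (h : xx ^ k = 1) : k = 0 := by
  have key : ∀ m : ℕ, xx ^ m = 1 → m = 0 := by
    intro m hm
    have h1 : algebraMap (Polynomial ℚ) (RatFunc ℚ) (Polynomial.X ^ m) =
        algebraMap (Polynomial ℚ) (RatFunc ℚ) 1 := by
      simpa [xx] using hm
    have h2 := RatFunc.algebraMap_injective ℚ h1
    simpa using congrArg Polynomial.natDegree h2
  rcases Int.eq_nat_or_neg k with ⟨m, rfl | rfl⟩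
  · rw [zpow_natCast] at h
    simpa using key m h
  · rw [zpow_neg, zpow_natCast, inv_eq_one] at h
    simpa using key m h

theorem xx_zpow_injective {a b : ℤ} (h : xx ^ a = xx ^ b) : a = b := by
  have h1 : xx ^ (a - b) = 1 := by
    rw [zpow_sub₀ xx_ne_zero, h, div_self (zpow_ne_zero _ xx_ne_zero)]
  have := xx_zpow_eq_one h1
  omega

/-- The monomial matrix whose row `r` has its nonzero entry `x ^ a r` in column `σ r`. -/
noncomputable def monomialMatrix {n : ℕ} (σ : Equiv.Perm (Fin n)) (a : Fin n → ℤ) :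
    Matrix (Fin n) (Fin n) (RatFunc ℚ) :=
  fun r c => if c = σ r then xx ^ a r else 0

section Monomial

open Finset

variable {n : ℕ}

theorem monomialMatrix_apply_ne_zero {σ : Equiv.Perm (Fin n)} {a : Fin n → ℤ} {r c : Fin n} :
    monomialMatrix σ a r c ≠ 0 ↔ c = σ r := by
  simp [monomialMatrix, zpow_ne_zero, xx_ne_zero]

theorem monomialMatrix_mul (σ τ : Equiv.Perm (Fin n)) (a b : Fin n → ℤ) :
    monomialMatrix σ a * monomialMatrix τ b = monomialMatrix (τ * σ) (fun r => a r + b (σ r)) := by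
  ext r e
  simp only [Matrix.mul_apply, monomialMatrix, ite_mul, zero_mul, Finset.sum_ite_eq',
    Finset.mem_univ, if_true, Equiv.Perm.mul_apply, zpow_add₀ xx_ne_zero]
  rw [mul_ite, mul_zero]

theorem monomialMatrix_one : monomialMatrix (1 : Equiv.Perm (Fin n)) 0 = 1 := by
  ext r c
  simp [monomialMatrix, Matrix.one_apply, eq_comm]

theorem monomialMatrix_injective {σ τ : Equiv.Perm (Fin n)} {a b : Fin n → ℤ}
    (h : monomialMatrix σ a = monomialMatrix τ b) : σ = τ ∧ a = b := by
  have hσ : ∀ r, σ r = τ r := by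
    intro r
    rw [← monomialMatrix_apply_ne_zero (σ := τ) (a := b), ← h, monomialMatrix_apply_ne_zero]
  refine ⟨Equiv.ext hσ, funext fun r => ?_⟩
  have h1 := congrFun (congrFun h r) (σ r)
  simp only [monomialMatrix, hσ, if_true] at h1
  exact xx_zpow_injective h1

theorem IsGinf.exists_monomialMatrix {w : Matrix (Fin n) (Fin n) (RatFunc ℚ)} (hw : IsGinf n w) :
    ∃ (σ : Equiv.Perm (Fin n)) (a : Fin n → ℤ), w = monomialMatrix σ a ∧ ∑ i, a i = 0 := by
  obtain ⟨hrow, hcol, hpow, hprod⟩ := hw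
  choose s hs hs' using hrow
  have hinj : Function.Injective s := by
    intro r r' h
    obtain ⟨_, _, hu⟩ := hcol (s r)
    rw [hu r (hs r), hu r' (by rw [h]; exact hs r')]
  choose a ha using fun r => hpow r (s r) (hs r)
  have hM : w = monomialMatrix (Equiv.ofBijective s (Finite.injective_iff_bijective.mp hinj)) a := by
    ext r c
    simp only [monomialMatrix, Equiv.ofBijective_apply]
    split_ifs with h
    · rw [h, ha]
    · by_contra h0
      exact h (hs' r c h0)
  refine ⟨_, a, hM, ?_⟩
  rw [hM] at hprod
  simp only [monomialMatrix, Finset.sum_ite_eq', Finset.mem_univ, if_true] at hprod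
  apply xx_zpow_eq_one
  rw [← hprod]
  have hsum : ∀ t : Finset (Fin n), xx ^ ∑ i ∈ t, a i = ∏ i ∈ t, xx ^ a i := by
    intro t
    induction t using Finset.induction_on with
    | empty => simp
    | insert i t hi ih => rw [Finset.sum_insert hi, Finset.prod_insert hi, zpow_add₀ xx_ne_zero, ih]
  exact hsum univ

/-- The adjacent transposition of rows `p` and `p + 1`. -/
def adjSwap (p : ℕ) (hp : p + 1 < n) : Equiv.Perm (Fin n) :=
  Equiv.swap ⟨p, by omega⟩ ⟨p + 1, hp⟩

/-- The exponents of a generator: `-i` in row `p`, `i` in row `p + 1`, and `0` elsewhere. -/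
def genExp (p : ℕ) (i : ℤ) (r : Fin n) : ℤ :=
  if r.val = p then -i else if r.val = p + 1 then i else 0

theorem adjSwap_left (p : ℕ) (hp : p + 1 < n) :
    adjSwap p hp ⟨p, by omega⟩ = ⟨p + 1, hp⟩ := Equiv.swap_apply_left _ _

theorem adjSwap_right (p : ℕ) (hp : p + 1 < n) :
    adjSwap p hp ⟨p + 1, hp⟩ = ⟨p, by omega⟩ := Equiv.swap_apply_right _ _

theorem adjSwap_of_ne (p : ℕ) (hp : p + 1 < n) {r : Fin n} (h1 : r.val ≠ p)
    (h2 : r.val ≠ p + 1) : adjSwap p hp r = r :=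
  Equiv.swap_apply_of_ne_of_ne (fun h => h1 (by rw [h])) (fun h => h2 (by rw [h]))

theorem adjSwap_val (p : ℕ) (hp : p + 1 < n) (r : Fin n) :
    (adjSwap p hp r).val = if r.val = p then p + 1 else if r.val = p + 1 then p else r.val := by
  unfold adjSwap
  rw [Equiv.swap_apply_def]
  simp only [Fin.ext_iff]
  split_ifs <;> simp_all

theorem adjSwap_mul_self (p : ℕ) (hp : p + 1 < n) : adjSwap p hp * adjSwap p hp = 1 :=
  Equiv.swap_mul_self _ _

/-- Row `p` and row `p + 1` are exchanged, with weights when `i ≠ 0`. -/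
noncomputable def genMatrix (p : ℕ) (hp : p + 1 < n) (i : ℤ) :
    Matrix (Fin n) (Fin n) (RatFunc ℚ) :=
  monomialMatrix (adjSwap p hp) (genExp p i)

theorem genExp_add_genExp_adjSwap (p : ℕ) (hp : p + 1 < n) (i : ℤ) (r : Fin n) :
    genExp p i r + genExp p i (adjSwap p hp r) = 0 := by
  simp only [genExp, adjSwap_val]
  split_ifs <;> omega

theorem genMatrix_mul_self (p : ℕ) (hp : p + 1 < n) (i : ℤ) :
    genMatrix p hp i * genMatrix p hp i = 1 := by
  rw [genMatrix, monomialMatrix_mul, adjSwap_mul_self, ← monomialMatrix_one]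
  congr 1
  funext r
  exact genExp_add_genExp_adjSwap p hp i r

theorem tMat_eq_genMatrix (hn : 2 ≤ n) (i : ℤ) : tMat n i = genMatrix 0 (by omega) i := by
  ext r c
  simp only [tMat, genMatrix, monomialMatrix, genExp, Fin.ext_iff, adjSwap_val]
  split_ifs <;> first | rfl | omega

theorem sMat_eq_genMatrix (p : ℕ) (hp : p + 1 < n) : sMat n (p + 2) = genMatrix p hp 0 := by
  ext r c
  simp only [sMat, genMatrix, monomialMatrix, genExp, Fin.ext_iff, adjSwap_val]
  split_ifs <;> first | rfl | omega

theorem mem_Xset_iff (hn : 2 ≤ n) {g : Matrix (Fin n) (Fin n) (RatFunc ℚ)} :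
    g ∈ Xset n ↔ ∃ (p : ℕ) (hp : p + 1 < n) (i : ℤ), (p = 0 ∨ i = 0) ∧ g = genMatrix p hp i := by
  constructor
  · rintro (⟨i, rfl⟩ | ⟨j, h3, hj, rfl⟩)
    · exact ⟨0, by omega, i, Or.inl rfl, tMat_eq_genMatrix hn i⟩
    · obtain ⟨p, rfl⟩ : ∃ p, j = p + 2 := ⟨j - 2, by omega⟩
      exact ⟨p, by omega, 0, Or.inr rfl, sMat_eq_genMatrix p (by omega)⟩
  · rintro ⟨p, hp, i, h, rfl⟩
    by_cases hp0 : p = 0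
    · subst hp0
      exact Or.inl ⟨i, (tMat_eq_genMatrix hn i).symm⟩
    · have hi : i = 0 := by tauto
      subst hi
      exact Or.inr ⟨p + 2, by omega, by omega, (sMat_eq_genMatrix p hp).symm⟩

/-- The number of nonzero entries strictly above and to the left of that of row `i`. -/
def aboveLeft (σ : Equiv.Perm (Fin n)) (i : Fin n) : ℕ :=
  #{r : Fin n | r < i ∧ σ r < σ i}

/-- The sign `-1` for the exponent `0`, and `1` for all others. -/
def expSign (a : ℤ) : ℤ := if a = 0 then -1 else 1

/-- The combinatorial length of `monomialMatrix σ a`. -/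
def monomialLength (σ : Equiv.Perm (Fin n)) (a : Fin n → ℤ) : ℤ :=
  ∑ i : Fin n, ((i.val : ℤ) + expSign (a i) * aboveLeft σ i)

theorem aboveLeft_le (σ : Equiv.Perm (Fin n)) (i : Fin n) : aboveLeft σ i ≤ i.val := by
  calc aboveLeft σ i ≤ #(Finset.Iio i) := Finset.card_le_card (by intro r; simp; tauto)
    _ = i.val := by simp

theorem aboveLeft_one (i : Fin n) : aboveLeft 1 i = i.val := by
  have : ({r : Fin n | r < i ∧ (1 : Equiv.Perm (Fin n)) r < (1 : Equiv.Perm (Fin n)) i} : Finset _)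
      = Finset.Iio i := by ext r; simp
  rw [aboveLeft, this]; simp

theorem monomialLength_nonneg (σ : Equiv.Perm (Fin n)) (a : Fin n → ℤ) :
    0 ≤ monomialLength σ a := by
  refine Finset.sum_nonneg fun i _ => ?_
  have := aboveLeft_le σ i
  unfold expSign
  split_ifs <;> omega

theorem monomialLength_one : monomialLength (1 : Equiv.Perm (Fin n)) 0 = 0 := by
  refine Finset.sum_eq_zero fun i _ => ?_
  simp [aboveLeft_one, expSign]

theorem aboveLeft_mul_adjSwap_of_ne (σ : Equiv.Perm (Fin n)) (p : ℕ) (hp : p + 1 < n) {i : Fin n}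
    (h1 : i.val ≠ p) (h2 : i.val ≠ p + 1) :
    aboveLeft (σ * adjSwap p hp) i = aboveLeft σ i := by
  refine Finset.card_bij' (fun r _ => adjSwap p hp r) (fun r _ => adjSwap p hp r) ?_ ?_ ?_ ?_
  · intro r hr
    simp only [Finset.mem_filter, Finset.mem_univ, true_and, Equiv.Perm.mul_apply,
      adjSwap_of_ne p hp h1 h2] at hr ⊢
    refine ⟨?_, hr.2⟩
    have := hr.1
    rw [Fin.lt_def] at this ⊢
    rw [adjSwap_val]
    split_ifs <;> omega
  · intro r hr
    simp only [Finset.mem_filter, Finset.mem_univ, true_and, Equiv.Perm.mul_apply,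
      adjSwap_of_ne p hp h1 h2] at hr ⊢
    refine ⟨?_, ?_⟩
    · have := hr.1
      rw [Fin.lt_def] at this ⊢
      rw [adjSwap_val]
      split_ifs <;> omega
    · rw [← Equiv.Perm.mul_apply (adjSwap p hp), adjSwap_mul_self]
      exact hr.2
  · intro r _
    rw [← Equiv.Perm.mul_apply, adjSwap_mul_self]; rfl
  · intro r _
    rw [← Equiv.Perm.mul_apply, adjSwap_mul_self]; rfl

theorem aboveLeft_mul_adjSwap_right (σ : Equiv.Perm (Fin n)) (p : ℕ) (hp : p + 1 < n) :
    aboveLeft (σ * adjSwap p hp) ⟨p + 1, hp⟩ =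
      aboveLeft σ ⟨p, by omega⟩ + if σ ⟨p + 1, hp⟩ < σ ⟨p, by omega⟩ then 1 else 0 := by
  have hmem : ∀ r : Fin n, (r < ⟨p + 1, hp⟩ ∧ σ (adjSwap p hp r) < σ ⟨p, by omega⟩) ↔
      (r < ⟨p, by omega⟩ ∧ σ r < σ ⟨p, by omega⟩) ∨
        (r = ⟨p, by omega⟩ ∧ σ ⟨p + 1, hp⟩ < σ ⟨p, by omega⟩) := by
    rintro ⟨r, hr⟩
    rcases lt_trichotomy r p with h | rfl | h
    · rw [adjSwap_of_ne p hp (by simp only; omega) (by simp only; omega)]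
      simp [h.ne, h, Nat.lt_succ_of_lt h]
    · simp [adjSwap_left]
    · simp [h.ne', not_lt_of_gt h, show ¬ r < p + 1 by omega]
  simp only [aboveLeft, Equiv.Perm.mul_apply, adjSwap_right, hmem]
  split_ifs with hlt
  · rw [← Finset.card_insert_of_notMem (a := ⟨p, by omega⟩) (by simp)]
    congr 1
    ext r
    simp only [Finset.mem_filter, Finset.mem_univ, true_and, hlt, and_true, Finset.mem_insert]
    exact or_comm
  · simp only [hlt, and_false, or_false, add_zero]

theorem aboveLeft_mul_adjSwap_left (σ : Equiv.Perm (Fin n)) (p : ℕ) (hp : p + 1 < n) :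
    aboveLeft σ ⟨p + 1, hp⟩ = aboveLeft (σ * adjSwap p hp) ⟨p, by omega⟩ +
      if σ ⟨p, by omega⟩ < σ ⟨p + 1, hp⟩ then 1 else 0 := by
  have := aboveLeft_mul_adjSwap_right (σ * adjSwap p hp) p hp
  rw [mul_assoc, adjSwap_mul_self, mul_one] at this
  simpa [adjSwap_left, adjSwap_right] using this

theorem genMatrix_mul_monomialMatrix (p : ℕ) (hp : p + 1 < n) (i : ℤ) (σ : Equiv.Perm (Fin n))
    (a : Fin n → ℤ) : genMatrix p hp i * monomialMatrix σ a =
      monomialMatrix (σ * adjSwap p hp) (fun r => genExp p i r + a (adjSwap p hp r)) :=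
  monomialMatrix_mul _ _ _ _

theorem monomialLength_gen (p : ℕ) (hp : p + 1 < n) {i : ℤ} (hi : p = 0 ∨ i = 0)
    (σ : Equiv.Perm (Fin n)) (a : Fin n → ℤ) :
    monomialLength (σ * adjSwap p hp) (fun r => genExp p i r + a (adjSwap p hp r)) =
      monomialLength σ a
      + (if σ ⟨p + 1, hp⟩ < σ ⟨p, by omega⟩ then expSign (i + a ⟨p, by omega⟩) else 0)
      - (if σ ⟨p, by omega⟩ < σ ⟨p + 1, hp⟩ then expSign (a ⟨p + 1, hp⟩) else 0) := by
  have hne : (⟨p, by omega⟩ : Fin n) ≠ ⟨p + 1, hp⟩ := by simp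
  have split : ∀ f : Fin n → ℤ, ∑ r, f r = f ⟨p, by omega⟩ + f ⟨p + 1, hp⟩ +
      ∑ r ∈ univ \ {⟨p, by omega⟩, ⟨p + 1, hp⟩}, f r := by
    intro f
    rw [← Finset.sum_sdiff (Finset.subset_univ {⟨p, by omega⟩, ⟨p + 1, hp⟩}),
      Finset.sum_pair hne, add_comm]
  unfold monomialLength
  rw [split, split (fun r => _ + expSign (a r) * _)]
  have hrest : ∀ r ∈ univ \ ({⟨p, by omega⟩, ⟨p + 1, hp⟩} : Finset (Fin n)),
      ((r.val : ℤ) + expSign (genExp p i r + a (adjSwap p hp r)) *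
        aboveLeft (σ * adjSwap p hp) r) = (r.val : ℤ) + expSign (a r) * aboveLeft σ r := by
    intro r hr
    simp only [Finset.mem_sdiff, Finset.mem_univ, true_and, Finset.mem_insert,
      Finset.mem_singleton, Fin.ext_iff, not_or] at hr
    rw [aboveLeft_mul_adjSwap_of_ne σ p hp hr.1 hr.2, adjSwap_of_ne p hp hr.1 hr.2]
    simp [genExp, hr.1, hr.2]
  rw [Finset.sum_congr rfl hrest]
  dsimp only
  rw [adjSwap_left, adjSwap_right, aboveLeft_mul_adjSwap_right,
    aboveLeft_mul_adjSwap_left]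
  have hgl : genExp p i (⟨p, by omega⟩ : Fin n) = -i := by simp [genExp]
  have hgr : genExp p i (⟨p + 1, hp⟩ : Fin n) = i := by simp [genExp]
  rw [hgl, hgr]
  have hA := aboveLeft_le σ ⟨p, by omega⟩
  have hB := aboveLeft_le (σ * adjSwap p hp) ⟨p, by omega⟩
  simp only at hA hB
  have e1 : expSign (i + a ⟨p, by omega⟩) * (aboveLeft σ ⟨p, by omega⟩ : ℤ) =
      expSign (a ⟨p, by omega⟩) * aboveLeft σ ⟨p, by omega⟩ := by
    rcases hi with h | rfl
    · rw [show aboveLeft σ ⟨p, by omega⟩ = 0 by omega]; simp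
    · simp
  have e2 : expSign (-i + a ⟨p + 1, hp⟩) * (aboveLeft (σ * adjSwap p hp) ⟨p, by omega⟩ : ℤ) =
      expSign (a ⟨p + 1, hp⟩) * aboveLeft (σ * adjSwap p hp) ⟨p, by omega⟩ := by
    rcases hi with h | rfl
    · rw [show aboveLeft (σ * adjSwap p hp) ⟨p, by omega⟩ = 0 by omega]; simp
    · simp
  split_ifs <;> push_cast <;> linarith

theorem monomialLength_gen_le (p : ℕ) (hp : p + 1 < n) {i : ℤ} (hi : p = 0 ∨ i = 0)
    (σ : Equiv.Perm (Fin n)) (a : Fin n → ℤ) :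
    monomialLength (σ * adjSwap p hp) (fun r => genExp p i r + a (adjSwap p hp r)) ≤
      monomialLength σ a + 1 := by
  rw [monomialLength_gen p hp hi]
  have h1 : ∀ b, expSign b ≤ 1 := by intro b; unfold expSign; split_ifs <;> omega
  have h2 : ∀ b, -1 ≤ expSign b := by intro b; unfold expSign; split_ifs <;> omega
  have := h1 (i + a ⟨p, by omega⟩)
  have := h2 (a ⟨p + 1, hp⟩)
  split_ifs <;> omega

theorem exists_descent (hn : 2 ≤ n) (σ : Equiv.Perm (Fin n)) (a : Fin n → ℤ)
    (ha : ∑ i, a i = 0) (hne : ¬(σ = 1 ∧ a = 0)) :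
    ∃ (p : ℕ) (hp : p + 1 < n) (i : ℤ), (p = 0 ∨ i = 0) ∧
      monomialLength (σ * adjSwap p hp) (fun r => genExp p i r + a (adjSwap p hp r)) =
        monomialLength σ a - 1 := by
  by_contra! hcon
  have hnd : ∀ (p : ℕ) (hp : p + 1 < n),
      σ ⟨p, by omega⟩ < σ ⟨p + 1, hp⟩ ∧ a ⟨p + 1, hp⟩ = 0 := by
    intro p
    induction p with
    | zero =>
      intro hp
      have h1 := hcon 0 hp (-a ⟨0, by omega⟩) (Or.inl rfl)
      rw [monomialLength_gen 0 hp (Or.inl rfl)] at h1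
      have hs : σ ⟨0, by omega⟩ ≠ σ ⟨0 + 1, hp⟩ := by simp
      rcases lt_or_gt_of_ne hs with h | h
      · refine ⟨h, ?_⟩
        by_contra h0
        exact h1 (by simp only [h, not_lt_of_gt h, if_true, if_false]; simp [expSign, h0])
      · exact absurd (by simp only [h, not_lt_of_gt h, if_true, if_false]; simp [expSign]; ring) h1
    | succ q ih =>
      intro hp
      have h0 := (ih (by omega)).2
      have h1 := hcon (q + 1) hp 0 (Or.inr rfl)
      rw [monomialLength_gen (q + 1) hp (Or.inr rfl)] at h1
      have hs : σ ⟨q + 1, by omega⟩ ≠ σ ⟨q + 1 + 1, hp⟩ := by simp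
      rcases lt_or_gt_of_ne hs with h | h
      · refine ⟨h, ?_⟩
        by_contra h0
        exact h1 (by simp only [h, not_lt_of_gt h, if_true, if_false]; simp [expSign, h0])
      · exact absurd (by
          simp only [h, not_lt_of_gt h, if_true, if_false, h0]; simp [expSign]; ring) h1
  apply hne
  obtain ⟨m, rfl⟩ : ∃ m, n = m + 1 := ⟨n - 1, by omega⟩
  constructor
  · have hmono : StrictMono σ := Fin.strictMono_iff_lt_succ.mpr fun i =>
      (hnd i.val (by omega)).1
    have : hmono.orderIsoOfSurjective σ σ.surjective = OrderIso.refl _ := Subsingleton.elim _ _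
    ext r
    exact congrArg Fin.val (DFunLike.congr_fun this r)
  · rw [Fin.sum_univ_succ] at ha
    have hs : ∀ i : Fin m, a i.succ = 0 := fun i => (hnd i.val (by omega)).2
    simp only [hs, Finset.sum_const_zero, add_zero] at ha
    funext r
    refine Fin.cases ha hs r

theorem sum_gen (p : ℕ) (hp : p + 1 < n) (i : ℤ) (a : Fin n → ℤ) :
    ∑ r, (genExp p i r + a (adjSwap p hp r)) = ∑ r, a r := by
  rw [Finset.sum_add_distrib, Equiv.sum_comp (adjSwap p hp) a]
  have h1 := Equiv.sum_comp (adjSwap p hp) (genExp p i)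
  have h2 : ∑ r, (genExp p i r + genExp p i (adjSwap p hp r)) = 0 :=
    Finset.sum_eq_zero fun r _ => genExp_add_genExp_adjSwap p hp i r
  rw [Finset.sum_add_distrib] at h2
  omega

theorem exists_word (hn : 2 ≤ n) (m : ℕ) : ∀ (σ : Equiv.Perm (Fin n)) (a : Fin n → ℤ),
    ∑ i, a i = 0 → monomialLength σ a = m →
    ∃ l : List (Matrix (Fin n) (Fin n) (RatFunc ℚ)),
      l.length = m ∧ (∀ g ∈ l, g ∈ Xset n) ∧ l.prod = monomialMatrix σ a := by
  induction m with
  | zero =>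
    intro σ a ha hm
    by_cases h : σ = 1 ∧ a = 0
    · obtain ⟨rfl, rfl⟩ := h
      exact ⟨[], rfl, by simp, by simp [monomialMatrix_one]⟩
    · obtain ⟨p, hp, i, -, hd⟩ := exists_descent hn σ a ha h
      have := monomialLength_nonneg (σ * adjSwap p hp)
        (fun r => genExp p i r + a (adjSwap p hp r))
      simp only [Nat.cast_zero] at hm
      omega
  | succ m ih =>
    intro σ a ha hm
    by_cases h : σ = 1 ∧ a = 0
    · obtain ⟨rfl, rfl⟩ := h
      rw [monomialLength_one] at hm
      omega
    · obtain ⟨p, hp, i, hi, hd⟩ := exists_descent hn σ a ha h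
      obtain ⟨l, hl, hX, hprod⟩ := ih _ _ ((sum_gen p hp i a).trans ha) (by rw [hd, hm]; simp)
      refine ⟨genMatrix p hp i :: l, by simp [hl], ?_, ?_⟩
      · intro g hg
        rcases List.mem_cons.mp hg with rfl | hg
        · exact (mem_Xset_iff hn).mpr ⟨p, hp, i, hi, rfl⟩
        · exact hX g hg
      · rw [List.prod_cons, hprod, ← genMatrix_mul_monomialMatrix, ← mul_assoc,
          genMatrix_mul_self, one_mul]

theorem exists_monomialMatrix_eq_prod (hn : 2 ≤ n)
    (l : List (Matrix (Fin n) (Fin n) (RatFunc ℚ))) (hl : ∀ g ∈ l, g ∈ Xset n) :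
    ∃ (σ : Equiv.Perm (Fin n)) (a : Fin n → ℤ),
      l.prod = monomialMatrix σ a ∧ monomialLength σ a ≤ l.length := by
  induction l with
  | nil => exact ⟨1, 0, by simp [monomialMatrix_one], by simp [monomialLength_one]⟩
  | cons g l ih =>
    obtain ⟨σ, a, hprod, hle⟩ := ih fun g hg => hl g (List.mem_cons_of_mem _ hg)
    obtain ⟨p, hp, i, hi, rfl⟩ := (mem_Xset_iff hn).mp (hl g List.mem_cons_self)
    refine ⟨_, _, by rw [List.prod_cons, hprod, genMatrix_mul_monomialMatrix], ?_⟩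
    have := monomialLength_gen_le p hp hi σ a
    push_cast [List.length_cons]
    omega

theorem len_monomialMatrix (hn : 2 ≤ n) (σ : Equiv.Perm (Fin n)) (a : Fin n → ℤ)
    (ha : ∑ i, a i = 0) : (len n (monomialMatrix σ a) : ℤ) = monomialLength σ a := by
  obtain ⟨m, hm⟩ := Int.eq_ofNat_of_zero_le (monomialLength_nonneg σ a)
  obtain ⟨l, hl⟩ := exists_word hn m σ a ha hm
  rw [hm]
  norm_cast
  refine le_antisymm (Nat.sInf_le ⟨l, hl⟩) ?_
  refine le_csInf ⟨m, l, hl⟩ ?_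
  rintro _ ⟨l', rfl, hX, hprod⟩
  obtain ⟨τ, b, hb, hle⟩ := exists_monomialMatrix_eq_prod hn l' hX
  obtain ⟨rfl, rfl⟩ := monomialMatrix_injective (hb.symm.trans hprod)
  rw [hm] at hle
  exact_mod_cast hle

theorem inv_of_mem_Xset (hn : 2 ≤ n) {g : Matrix (Fin n) (Fin n) (RatFunc ℚ)} (hg : g ∈ Xset n) :
    g⁻¹ = g := by
  obtain ⟨p, hp, i, -, rfl⟩ := (mem_Xset_iff hn).mp hg
  exact Matrix.inv_eq_right_inv (genMatrix_mul_self p hp i)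

theorem prod_reverse_of_mem_Xset (hn : 2 ≤ n) (l : List (Matrix (Fin n) (Fin n) (RatFunc ℚ)))
    (hl : ∀ g ∈ l, g ∈ Xset n) : l.reverse.prod = l.prod⁻¹ := by
  rw [Matrix.list_prod_inv_reverse]
  congr 1
  symm
  conv_rhs => rw [← List.map_id l.reverse]
  exact List.map_congr_left fun g hg => inv_of_mem_Xset hn (hl g (List.mem_reverse.mp hg))

theorem monomialMatrix_mul_inv (σ : Equiv.Perm (Fin n)) (a : Fin n → ℤ) :
    monomialMatrix σ a * monomialMatrix σ⁻¹ (fun r => -a (σ⁻¹ r)) = 1 := by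
  rw [monomialMatrix_mul, ← monomialMatrix_one]
  congr 1
  · simp
  · funext r; simp

theorem isUnit_det_monomialMatrix (σ : Equiv.Perm (Fin n)) (a : Fin n → ℤ) :
    IsUnit (monomialMatrix σ a).det :=
  Matrix.isUnit_det_of_right_inverse (monomialMatrix_mul_inv σ a)

theorem len_inv_monomialMatrix (hn : 2 ≤ n) (σ : Equiv.Perm (Fin n)) (a : Fin n → ℤ) :
    len n (monomialMatrix σ a)⁻¹ = len n (monomialMatrix σ a) := by
  unfold len
  congr 1
  ext m
  constructor
  · rintro ⟨l, hl, hX, hprod⟩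
    refine ⟨l.reverse, by simpa using hl, by simpa using hX, ?_⟩
    rw [prod_reverse_of_mem_Xset hn l hX, hprod,
      Matrix.nonsing_inv_nonsing_inv _ (isUnit_det_monomialMatrix σ a)]
  · rintro ⟨l, hl, hX, hprod⟩
    refine ⟨l.reverse, by simpa using hl, by simpa using hX, ?_⟩
    rw [prod_reverse_of_mem_Xset hn l hX, hprod]

/-- The exponents of `λ`. -/
def lamExp (i : Fin n) : ℤ := if i.val = 0 then -((n : ℤ) - 1) else 1

theorem sum_lamExp (hn : 2 ≤ n) : ∑ i : Fin n, lamExp i = 0 := by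
  obtain ⟨m, rfl⟩ : ∃ m, n = m + 1 := ⟨n - 1, by omega⟩
  rw [Fin.sum_univ_succ]
  simp [lamExp]

theorem lam_eq_monomialMatrix : lam n = monomialMatrix 1 lamExp := by
  ext r c
  by_cases h : r = c
  · subst h
    simp only [lam, Matrix.diagonal_apply_eq, monomialMatrix, lamExp, Equiv.Perm.one_apply, if_true]
    split_ifs <;> simp
  · simp [lam, monomialMatrix, h, Ne.symm h]

theorem monomialMatrix_one_zpow (a : Fin n → ℤ) (k : ℤ) :
    monomialMatrix (1 : Equiv.Perm (Fin n)) a ^ k = monomialMatrix 1 (fun r => k * a r) := by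
  have hu := isUnit_det_monomialMatrix 1 a
  have hinv : (monomialMatrix 1 a)⁻¹ = monomialMatrix 1 (fun r => -a r) := by
    simpa using Matrix.inv_eq_right_inv (monomialMatrix_mul_inv 1 a)
  induction k with
  | zero =>
    rw [zpow_zero, ← monomialMatrix_one]
    congr 1; funext r; simp
  | succ i ih =>
    rw [Matrix.zpow_add_one hu, ih, monomialMatrix_mul]
    congr 1; funext r; simp; ring
  | pred i ih =>
    rw [Matrix.zpow_sub_one hu, ih, hinv, monomialMatrix_mul]
    congr 1; funext r; simp; ring

theorem aboveLeft_eq_zero_of_mem_Zset {σ : Equiv.Perm (Fin n)} {a : Fin n → ℤ} {j : Fin n}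
    (h : (j, σ j) ∈ Zset n (monomialMatrix σ a)) : aboveLeft σ j = 0 := by
  obtain ⟨i, c, hb, hj, hc⟩ := h
  simp only at hj hc
  rw [aboveLeft, Finset.card_eq_zero, Finset.filter_eq_empty_iff]
  rintro r - ⟨h1, h2⟩
  refine monomialMatrix_apply_ne_zero.mpr rfl
    (hb r (σ r) (h1.le.trans hj) (h2.le.trans hc) ?_)
  rintro ⟨rfl, -⟩
  exact absurd h1 (not_lt.mpr hj)

theorem mem_Zset_of_aboveLeft_eq_zero {σ : Equiv.Perm (Fin n)} {a : Fin n → ℤ} {j : Fin n}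
    (h : aboveLeft σ j = 0) : (j, σ j) ∈ Zset n (monomialMatrix σ a) := by
  rw [aboveLeft, Finset.card_eq_zero, Finset.filter_eq_empty_iff] at h
  refine ⟨j, σ j, ?_, le_rfl, le_rfl⟩
  intro r d hr hd hne
  by_contra h0
  obtain rfl := monomialMatrix_apply_ne_zero.mp h0
  have hrj : r ≠ j := by rintro rfl; exact hne ⟨rfl, rfl⟩
  exact h (Finset.mem_univ r)
    ⟨lt_of_le_of_ne hr hrj, lt_of_le_of_ne hd fun e => hrj (σ.injective e)⟩

theorem entries_condition_iff {σ : Equiv.Perm (Fin n)} {a : Fin n → ℤ} {k : ℤ} :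
    (∀ j d : Fin n, (j, d) ∉ Zset n (monomialMatrix σ a) →
      (monomialMatrix σ a j d = 0 ∨ monomialMatrix σ a j d = 1 ∨
        monomialMatrix σ a j d = xx ^ k)) ↔
    ∀ j, aboveLeft σ j = 0 ∨ a j = 0 ∨ a j = k := by
  constructor
  · intro h j
    by_cases hA : aboveLeft σ j = 0
    · exact Or.inl hA
    · right
      have hval : monomialMatrix σ a j (σ j) = xx ^ a j := by simp [monomialMatrix]
      rcases h j (σ j) fun hZ => hA (aboveLeft_eq_zero_of_mem_Zset hZ) with h | h | h
      · exact absurd h (monomialMatrix_apply_ne_zero.mpr rfl)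
      · exact Or.inl (xx_zpow_eq_one (hval.symm.trans h))
      · exact Or.inr (xx_zpow_injective (hval.symm.trans h))
  · intro h j d hZ
    by_cases hd : d = σ j
    · subst hd
      right
      rcases h j with h | h | h
      · exact absurd (mem_Zset_of_aboveLeft_eq_zero h) hZ
      · left; simp [monomialMatrix, h]
      · right; simp [monomialMatrix, h]
    · left; simp [monomialMatrix, hd]

theorem monomialLength_lam_zpow {k : ℤ} (hk : k ≠ 0) :
    monomialLength (1 : Equiv.Perm (Fin n)) (fun r => k * lamExp r) =
      ∑ i : Fin n, 2 * (i.val : ℤ) := by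
  refine Finset.sum_congr rfl fun i _ => ?_
  rw [aboveLeft_one]
  by_cases h : i.val = 0
  · simp [h]
  · simp [lamExp, h, expSign, hk]; ring

theorem monomialLength_add_eq_iff {σ : Equiv.Perm (Fin n)} {a : Fin n → ℤ} {k : ℤ} (hk : k ≠ 0) :
    monomialLength σ a + monomialLength σ (fun r => -k * lamExp r + a r) =
      ∑ i : Fin n, 2 * (i.val : ℤ) ↔ ∀ j, aboveLeft σ j = 0 ∨ a j = 0 ∨ a j = k := by
  have hsum : monomialLength σ a + monomialLength σ (fun r => -k * lamExp r + a r) =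
      ∑ i : Fin n, 2 * (i.val : ℤ) +
      ∑ i : Fin n, (expSign (a i) + expSign (-k * lamExp i + a i)) * aboveLeft σ i := by
    unfold monomialLength
    rw [← Finset.sum_add_distrib, ← Finset.sum_add_distrib]
    exact Finset.sum_congr rfl fun i _ => by ring
  have hterm : ∀ i : Fin n, (expSign (a i) + expSign (-k * lamExp i + a i)) * aboveLeft σ i =
      if aboveLeft σ i = 0 ∨ a i = 0 ∨ a i = k then 0 else 2 * (aboveLeft σ i : ℤ) := by
    intro i
    by_cases hA : aboveLeft σ i = 0
    · simp [hA]
    · have hi : i.val ≠ 0 := by have := aboveLeft_le σ i; omega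
      simp only [lamExp, hi, hA, false_or, if_false, mul_one, expSign]
      split_ifs <;> omega
  rw [hsum, add_eq_left, Finset.sum_eq_zero_iff_of_nonneg]
  · refine forall_congr' fun i => ?_
    rw [hterm]
    simp only [Finset.mem_univ, forall_true_left]
    split_ifs with h
    · simp [h]
    · simp only [h, iff_false]
      push Not at h
      omega
  · intro i _
    rw [hterm]
    split_ifs <;> omega

end Monomial

/-- `w ⪯ λ^k` iff every entry of `w` at an index in `Z'(w)` is `0`, `1`,
or `x^k`. -/
theorem stmt_4 (n : ℕ) (hn : 2 ≤ n) (k : ℤ) (hk : k ≠ 0)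
    (w : Matrix (Fin n) (Fin n) (RatFunc ℚ)) (hw : IsGinf n w) :
    preL n w ((lam n) ^ k) ↔
      ∀ j d : Fin n, (j, d) ∉ Zset n w →
        (w j d = 0 ∨ w j d = 1 ∨ w j d = xx ^ k) := by
  obtain ⟨σ, a, rfl, ha⟩ := hw.exists_monomialMatrix
  have hlam : lam n ^ k = monomialMatrix 1 (fun r => k * lamExp r) := by
    rw [lam_eq_monomialMatrix, monomialMatrix_one_zpow]
  have hmul : monomialMatrix σ a = monomialMatrix 1 (fun r => k * lamExp r) *
      monomialMatrix σ (fun r => -k * lamExp r + a r) := by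
    rw [monomialMatrix_mul]
    congr 1
    funext r
    simp
  have hquot : (monomialMatrix σ a)⁻¹ * monomialMatrix 1 (fun r => k * lamExp r) =
      (monomialMatrix σ (fun r => -k * lamExp r + a r))⁻¹ := by
    rw [hmul, Matrix.mul_inv_rev, mul_assoc,
      Matrix.nonsing_inv_mul _ (isUnit_det_monomialMatrix 1 _), mul_one]
  have hlamsum : ∀ c : ℤ, ∑ r : Fin n, c * lamExp r = 0 := by
    intro c
    rw [← Finset.mul_sum, sum_lamExp hn, mul_zero]
  rw [preL, hlam, hquot, len_inv_monomialMatrix hn, entries_condition_iff,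
    ← monomialLength_add_eq_iff hk, ← monomialLength_lam_zpow hk,
    ← len_monomialMatrix hn σ a ha,
    ← len_monomialMatrix hn σ _ (by rw [Finset.sum_add_distrib, hlamsum, ha, add_zero]),
    ← len_monomialMatrix hn 1 _ (hlamsum k)]
  norm_cast
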